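/- Uniqueness of the optimal return: let Q be a probability measure on 𝒰 and suppose b̄ and b̃ both maximize b ↦ ∫ log⟨b, u⟩ dQ(u) over Δ, with the maximal value finite. Then ⟨b̄, u⟩ = ⟨b̃, u⟩ for Q-almost every u. (Paper's Lemma 4(a).) -/

import Mathlib

open MeasureTheory Filter
open scoped BigOperators ENNReal Topology

/-- Inner product of two vectors in `ℝ^m`. -/
noncomputable def ip {m : ℕ} (b x : Fin m → ℝ) : ℝ := ∑ i, b i * x i

/-- The closed portfolio simplex. -/
def simplex (m : ℕ) : Set (Fin m → ℝ) := {b | (∀ i, 0 ≤ b i) ∧ ∑ i, b i = 1}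

/-- The uniform reference portfolio `b̂ = (1/m, …, 1/m)`. -/
noncomputable def bhat (m : ℕ) : Fin m → ℝ := fun _ => (m : ℝ)⁻¹

/-- The set `𝒰` of normalized return vectors. -/
def Uset (m : ℕ) : Set (Fin m → ℝ) := {u | (∀ i, 0 < u i) ∧ ip (bhat m) u = 1}

/-- `nlog m r` is the nonnegative extended-real value `log m − log r`, set to `∞` for `r ≤ 0`. -/
noncomputable def nlog (m : ℕ) (r : ℝ) : ℝ≥0∞ :=
  if r ≤ 0 then ⊤ else ENNReal.ofReal (Real.log m - Real.log r)

/-- `∫ log⟨b, u⟩ dQ(u) ∈ [−∞, log m]` for a measure `Q` supported on `𝒰`. -/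
noncomputable def elogQ {m : ℕ} (Q : Measure (Fin m → ℝ)) (b : Fin m → ℝ) : EReal :=
  (Real.log m : EReal) - ((∫⁻ u, nlog m (ip b u) ∂Q : ℝ≥0∞) : EReal)

theorem ip_pos {m : ℕ} {b u : Fin m → ℝ} (hb : b ∈ simplex m) (hu : u ∈ Uset m) :
    0 < ip b u := by
  obtain ⟨hb0, hb1⟩ := hb
  have hex : ∃ i, 0 < b i := by
    by_contra! h
    have : ∑ i, b i ≤ 0 := Finset.sum_nonpos fun i _ => h i
    linarith
  obtain ⟨i, hi⟩ := hex
  exact Finset.sum_pos' (fun j _ => mul_nonneg (hb0 j) (hu.1 j).le)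
    ⟨i, Finset.mem_univ i, mul_pos hi (hu.1 i)⟩

theorem sum_eq_of_mem_Uset {m : ℕ} (hm : 2 ≤ m) {u : Fin m → ℝ} (hu : u ∈ Uset m) :
    ∑ i, u i = m := by
  have h := hu.2
  have hm0 : (m : ℝ) ≠ 0 := by positivity
  simp only [ip, bhat, ← Finset.mul_sum] at h
  field_simp at h
  linarith

theorem ip_le {m : ℕ} (hm : 2 ≤ m) {b u : Fin m → ℝ} (hb : b ∈ simplex m) (hu : u ∈ Uset m) :
    ip b u ≤ m := by
  rw [← sum_eq_of_mem_Uset hm hu]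
  refine Finset.sum_le_sum fun i _ => mul_le_of_le_one_left (hu.1 i).le ?_
  rw [← hb.2]
  exact Finset.single_le_sum (fun j _ => hb.1 j) (Finset.mem_univ i)

theorem ip_add_smul {m : ℕ} (s t : ℝ) (a b u : Fin m → ℝ) :
    ip (s • a + t • b) u = s * ip a u + t * ip b u := by
  simp [ip, Finset.mul_sum, ← Finset.sum_add_distrib, add_mul, mul_assoc]

theorem midpoint_mem_simplex {m : ℕ} {a b : Fin m → ℝ} (ha : a ∈ simplex m)
    (hb : b ∈ simplex m) : (1 / 2 : ℝ) • a + (1 / 2 : ℝ) • b ∈ simplex m := by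
  refine ⟨fun i => ?_, ?_⟩
  · have := ha.1 i
    have := hb.1 i
    simp only [Pi.add_apply, Pi.smul_apply, smul_eq_mul]
    positivity
  · simp only [Pi.add_apply, Pi.smul_apply, smul_eq_mul, Finset.sum_add_distrib,
      ← Finset.mul_sum, ha.2, hb.2]
    norm_num

theorem measurable_nlog_ip {m : ℕ} (b : Fin m → ℝ) : Measurable fun u => nlog m (ip b u) := by
  have hip : Measurable fun u => ip b u := by
    unfold ip
    fun_prop
  have hn : Measurable (nlog m) :=
    Measurable.ite measurableSet_Iic measurable_const
      (ENNReal.measurable_ofReal.comp (Real.measurable_log.const_sub _))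
  exact hn.comp hip

/-- Maximizing `elogQ` is minimizing the integral of `nlog`. -/
theorem elogQ_le_elogQ_iff {m : ℕ} {Q : Measure (Fin m → ℝ)} {a b : Fin m → ℝ} :
    elogQ Q a ≤ elogQ Q b ↔ ∫⁻ u, nlog m (ip b u) ∂Q ≤ ∫⁻ u, nlog m (ip a u) ∂Q := by
  unfold elogQ
  generalize ∫⁻ u, nlog m (ip a u) ∂Q = x
  generalize ∫⁻ u, nlog m (ip b u) ∂Q = y
  refine ⟨fun h => ?_, fun h => EReal.sub_le_sub le_rfl (EReal.coe_ennreal_le_coe_ennreal_iff.2 h)⟩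
  induction x with
  | top => exact le_top
  | coe x =>
    induction y with
    | top =>
      rw [EReal.coe_ennreal_top, EReal.sub_top, le_bot_iff] at h
      exact absurd h (by simp [EReal.coe_nnreal_eq_coe_real, ← EReal.coe_sub])
    | coe y =>
      simp only [EReal.coe_nnreal_eq_coe_real, ← EReal.coe_sub, EReal.coe_le_coe_iff] at h
      have h' : (y : ℝ) ≤ x := by linarith
      exact_mod_cast h'

theorem lintegral_nlog_ne_top {m : ℕ} {Q : Measure (Fin m → ℝ)} {b : Fin m → ℝ}
    (h : ⊥ < elogQ Q b) : ∫⁻ u, nlog m (ip b u) ∂Q ≠ ⊤ := by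
  intro htop
  rw [elogQ, htop, EReal.coe_ennreal_top, EReal.sub_top] at h
  exact lt_irrefl _ h

theorem nlog_of_pos {m : ℕ} {r : ℝ} (hr : 0 < r) :
    nlog m r = ENNReal.ofReal (Real.log m - Real.log r) :=
  if_neg hr.not_ge

theorem nlog_add_nlog {m : ℕ} {r s : ℝ} (hr : 0 < r) (hrm : r ≤ m) (hs : 0 < s) (hsm : s ≤ m) :
    nlog m r + nlog m s =
      ENNReal.ofReal ((Real.log m - Real.log r) + (Real.log m - Real.log s)) := by
  rw [nlog_of_pos hr, nlog_of_pos hs, ENNReal.ofReal_add] <;>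
    exact sub_nonneg.2 (Real.log_le_log (by assumption) (by assumption))

theorem nlog_midpoint_lt {m : ℕ} {r s : ℝ} (hr : 0 < r) (hrm : r ≤ m) (hs : 0 < s)
    (hsm : s ≤ m) (hne : r ≠ s) :
    nlog m (1 / 2 * r + 1 / 2 * s) + nlog m (1 / 2 * r + 1 / 2 * s) < nlog m r + nlog m s := by
  have hconc := strictConcaveOn_log_Ioi.2 (Set.mem_Ioi.2 hr) (Set.mem_Ioi.2 hs) hne
    one_half_pos one_half_pos (add_halves 1)
  simp only [smul_eq_mul] at hconc
  have hp : 0 < 1 / 2 * r + 1 / 2 * s := by positivity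
  have hpm : 1 / 2 * r + 1 / 2 * s ≤ m := by linarith
  have hlog := Real.log_le_log hp hpm
  rw [nlog_add_nlog hr hrm hs hsm, nlog_add_nlog hp hpm hp hpm, ENNReal.ofReal_lt_ofReal_iff']
  constructor <;> linarith

theorem nlog_midpoint_le {m : ℕ} {r s : ℝ} (hr : 0 < r) (hrm : r ≤ m) (hs : 0 < s)
    (hsm : s ≤ m) :
    nlog m (1 / 2 * r + 1 / 2 * s) + nlog m (1 / 2 * r + 1 / 2 * s) ≤ nlog m r + nlog m s := by
  rcases eq_or_ne r s with rfl | hne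
  · rw [← add_mul, add_halves, one_mul]
  · exact (nlog_midpoint_lt hr hrm hs hsm hne).le

/-- Lemma 4(a): any two log-optimal portfolios with finite optimal value have `Q`-a.e.
identical returns. -/
theorem stmt_7 (m : ℕ) (hm : 2 ≤ m)
    (Q : Measure (Fin m → ℝ)) [IsProbabilityMeasure Q] (hQ : ∀ᵐ u ∂Q, u ∈ Uset m)
    (bbar btil : Fin m → ℝ) (hbbar : bbar ∈ simplex m) (hbtil : btil ∈ simplex m)
    (hmaxbar : ∀ b ∈ simplex m, elogQ Q b ≤ elogQ Q bbar)
    (hmaxtil : ∀ b ∈ simplex m, elogQ Q b ≤ elogQ Q btil)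
    (hfin : (⊥ : EReal) < elogQ Q bbar) :
    ∀ᵐ u ∂Q, ip bbar u = ip btil u := by
  have hmid := midpoint_mem_simplex hbbar hbtil
  have hbar := elogQ_le_elogQ_iff.1 (hmaxbar _ hmid)
  have htil := elogQ_le_elogQ_iff.1 (hmaxtil _ hmid)
  have hfinbar := lintegral_nlog_ne_top hfin
  have htilbar := elogQ_le_elogQ_iff.1 (hmaxtil _ hbbar)
  set c := (1 / 2 : ℝ) • bbar + (1 / 2 : ℝ) • btil with hc
  have hle : (fun u => nlog m (ip c u) + nlog m (ip c u)) ≤ᵐ[Q]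
      fun u => nlog m (ip bbar u) + nlog m (ip btil u) := by
    filter_upwards [hQ] with u hu
    rw [hc, ip_add_smul]
    exact nlog_midpoint_le (ip_pos hbbar hu) (ip_le hm hbbar hu) (ip_pos hbtil hu)
      (ip_le hm hbtil hu)
  have hint := lintegral_mono_ae hle
  have hsum : ∫⁻ u, (nlog m (ip bbar u) + nlog m (ip btil u)) ∂Q ≠ ⊤ := by
    rw [lintegral_add_left (measurable_nlog_ip bbar)]
    exact ENNReal.add_ne_top.2 ⟨hfinbar, ne_top_of_le_ne_top hfinbar htilbar⟩
  have hae := ae_eq_of_ae_le_of_lintegral_le hle (ne_top_of_le_ne_top hsum hint)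
    ((measurable_nlog_ip bbar).add (measurable_nlog_ip btil)).aemeasurable (by
      rw [lintegral_add_left (measurable_nlog_ip bbar), lintegral_add_left (measurable_nlog_ip c)]
      exact add_le_add hbar htil)
  filter_upwards [hQ, hae] with u hu heq
  by_contra hne
  rw [hc, ip_add_smul] at heq
  exact (nlog_midpoint_lt (ip_pos hbbar hu) (ip_le hm hbbar hu) (ip_pos hbtil hu)
    (ip_le hm hbtil hu) hne).ne heq
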